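/- Let n ≥ 3 and 2 ≤ k < n, and let G = P_n^k be the k-th power of the path on n vertices. Then G is gap-vertex-labelable if and only if (n = 3 and k = 2), or (n = 4 and k = 2), or (n ≥ 5 and 2k < n). -/

import Mathlib

/-- The neighbourhood of `v` in `G` as a `Finset` (classically decidable). -/
noncomputable def gapNbhd {V : Type*} [Fintype V] (G : SimpleGraph V) (v : V) : Finset V :=
  @Finset.filter V (fun u => G.Adj v u) (Classical.decPred _) Finset.univ

/-- The colouring induced by a vertex-labelling `π` : a vertex with at least two neighbours
gets the gap `max − min` of the labels of its neighbours, a vertex with exactly one neighbour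
`u` gets `π u`, and an isolated vertex gets `1`. -/
noncomputable def gapColor {V : Type*} [Fintype V] (G : SimpleGraph V) (π : V → ℕ) (v : V) : ℕ :=
  if h : ((gapNbhd G v).image π).Nonempty then
    if 2 ≤ (gapNbhd G v).card then
      ((gapNbhd G v).image π).max' h - ((gapNbhd G v).image π).min' h
    else ((gapNbhd G v).image π).max' h
  else 1

/-- `π` is a gap-`[k]`-vertex-labelling of `G`: the labels lie in `{1, …, k}` and the induced
colouring is proper. -/
def IsGapLabelling {V : Type*} [Fintype V] (G : SimpleGraph V) (k : ℕ) (π : V → ℕ) : Prop :=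
  (∀ v, 1 ≤ π v ∧ π v ≤ k) ∧
  ∀ u v, G.Adj u v → gapColor G π u ≠ gapColor G π v

/-- `G` is gap-vertex-labelable if it admits a gap-`[k]`-vertex-labelling for some `k ≥ 1`. -/
def GapVertexLabelable {V : Type*} [Fintype V] (G : SimpleGraph V) : Prop :=
  ∃ k, 1 ≤ k ∧ ∃ π, IsGapLabelling G k π

/-- The vertex-gap number: the least `k ≥ 1` for which `G` admits a
gap-`[k]`-vertex-labelling. -/
noncomputable def vertexGapNumber {V : Type*} [Fintype V] (G : SimpleGraph V) : ℕ :=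
  sInf {k | 1 ≤ k ∧ ∃ π, IsGapLabelling G k π}

/-- The `k`-th power of the path on `n` vertices: vertices `0, …, n − 1`, with distinct `i`, `j`
adjacent iff `|i − j| ≤ k`. -/
def pathPower (n k : ℕ) : SimpleGraph (Fin n) :=
  SimpleGraph.fromRel (fun i j => i.val ≤ j.val ∧ j.val - i.val ≤ k)

theorem mem_gapNbhd {V : Type*} [Fintype V] {G : SimpleGraph V} {v u : V} :
    u ∈ gapNbhd G v ↔ G.Adj v u := by
  simp [gapNbhd]

/-- If `a ≠ b` are neighbours of `v` carrying the largest and the smallest label on the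
neighbourhood of `v`, then the colour of `v` is `π a - π b`. -/
theorem gapColor_eq_sub {V : Type*} [Fintype V] {G : SimpleGraph V} {π : V → ℕ} {v a b : V}
    (hab : a ≠ b) (ha : G.Adj v a) (hb : G.Adj v b)
    (hmax : ∀ x, G.Adj v x → π x ≤ π a) (hmin : ∀ x, G.Adj v x → π b ≤ π x) :
    gapColor G π v = π a - π b := by
  have ha' := mem_gapNbhd.2 ha
  have hb' := mem_gapNbhd.2 hb
  have hne : ((gapNbhd G v).image π).Nonempty := ⟨π a, Finset.mem_image_of_mem π ha'⟩
  have hcard : 2 ≤ (gapNbhd G v).card := Finset.one_lt_card.2 ⟨a, ha', b, hb', hab⟩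
  have hM : ((gapNbhd G v).image π).max' hne = π a := by
    refine le_antisymm (Finset.max'_le _ _ _ ?_)
      (Finset.le_max' _ _ (Finset.mem_image_of_mem π ha'))
    simpa [mem_gapNbhd] using hmax
  have hm : ((gapNbhd G v).image π).min' hne = π b := by
    refine le_antisymm (Finset.min'_le _ _ (Finset.mem_image_of_mem π hb'))
      (Finset.le_min' _ _ _ ?_)
    simpa [mem_gapNbhd] using hmin
  rw [gapColor, dif_pos hne, if_pos hcard, hM, hm]

/-- A graph with two universal vertices `u ≠ w` and at least one further vertex is not
gap-vertex-labelable if each further vertex has a neighbour other than `u` and `w`. -/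
theorem not_gapVertexLabelable_of_universal_pair {V : Type*} [Fintype V] {G : SimpleGraph V}
    {u w t : V} (huw : u ≠ w) (hu : ∀ x, x ≠ u → G.Adj u x) (hw : ∀ x, x ≠ w → G.Adj w x)
    (htu : t ≠ u) (htw : t ≠ w)
    (hnb : ∀ x, x ≠ u → x ≠ w → ∃ y, y ≠ u ∧ y ≠ w ∧ G.Adj x y) :
    ¬ GapVertexLabelable G := by
  rintro ⟨-, -, π, -, hproper⟩
  obtain ⟨a, b, hab, hmax, hmin⟩ : ∃ a b, a ≠ b ∧ (∀ x, π x ≤ π a) ∧ ∀ x, π b ≤ π x := by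
    have : Nonempty V := ⟨u⟩
    obtain ⟨a, ha⟩ := Finite.exists_max π
    obtain ⟨b, hb⟩ := Finite.exists_min π
    by_cases hab : a = b
    · subst hab
      exact ⟨u, w, huw, fun x => (ha x).trans (hb u), fun x => (ha w).trans (hb x)⟩
    · exact ⟨a, b, hab, ha, hb⟩
  have full : ∀ x y, G.Adj x y → G.Adj x a → G.Adj x b → G.Adj y a → G.Adj y b → False := by
    intro x y hxy hxa hxb hya hyb
    apply hproper x y hxy
    rw [gapColor_eq_sub hab hxa hxb (fun z _ => hmax z) (fun z _ => hmin z),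
      gapColor_eq_sub hab hya hyb (fun z _ => hmax z) (fun z _ => hmin z)]
  by_cases hpair : (a = u ∨ a = w) ∧ (b = u ∨ b = w)
  · obtain ⟨s, hsu, hsw, hts⟩ := hnb t htu htw
    have hadj : ∀ x, x ≠ u → x ≠ w → G.Adj x a ∧ G.Adj x b := by
      intro x hxu hxw
      have h₁ := (hu x hxu).symm
      have h₂ := (hw x hxw).symm
      rcases hpair with ⟨rfl | rfl, rfl | rfl⟩ <;> exact ⟨by assumption, by assumption⟩
    exact full t s hts (hadj t htu htw).1 (hadj t htu htw).2 (hadj s hsu hsw).1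
      (hadj s hsu hsw).2
  · have hext : ∀ p q, p ≠ q → (∀ x, x ≠ p → G.Adj p x) → (∀ x, x ≠ q → G.Adj q x) →
        (∀ x, x ≠ p → x ≠ q → ∃ y, y ≠ p ∧ y ≠ q ∧ G.Adj x y) →
        ((a = p ∧ b ≠ p ∧ b ≠ q) ∨ (b = p ∧ a ≠ p ∧ a ≠ q)) → False := by
      rintro p q hpq hp hq hnb (⟨rfl, h₁, h₂⟩ | ⟨rfl, h₁, h₂⟩)
      · obtain ⟨s, hs₁, hs₂, hbs⟩ := hnb b h₁ h₂
        exact full q s (hq s hs₂) (hq a hpq) (hq b h₂) (hp s hs₁).symm hbs.symm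
      · obtain ⟨s, hs₁, hs₂, has⟩ := hnb a h₁ h₂
        exact full q s (hq s hs₂) (hq a h₂) (hq b hpq) has.symm (hp s hs₁).symm
    have hnb' : ∀ x, x ≠ w → x ≠ u → ∃ y, y ≠ w ∧ y ≠ u ∧ G.Adj x y := by
      intro x hxw hxu
      obtain ⟨y, h₁, h₂, h₃⟩ := hnb x hxu hxw
      exact ⟨y, h₂, h₁, h₃⟩
    have hu' := hext u w huw hu hw hnb
    have hw' := hext w u huw.symm hw hu hnb'
    by_cases hnone : a ≠ u ∧ a ≠ w ∧ b ≠ u ∧ b ≠ w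
    · obtain ⟨h₁, h₂, h₃, h₄⟩ := hnone
      exact full u w (hu w huw.symm) (hu a h₁) (hu b h₃) (hw a h₂) (hw b h₄)
    · grind

theorem pathPower_adj {n k : ℕ} {i j : Fin n} :
    (pathPower n k).Adj i j ↔ i.val ≠ j.val ∧ i.val ≤ j.val + k ∧ j.val ≤ i.val + k := by
  rw [pathPower, SimpleGraph.fromRel_adj, ne_eq, Fin.ext_iff]
  omega

theorem not_gapVertexLabelable_pathPower {n k : ℕ} (hk : 3 ≤ k) (hkn : k < n)
    (hnk : n ≤ 2 * k) : ¬ GapVertexLabelable (pathPower n k) := by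
  refine not_gapVertexLabelable_of_universal_pair (u := ⟨k - 1, by omega⟩) (w := ⟨k, by omega⟩)
    (t := ⟨0, by omega⟩) ?_ ?_ ?_ ?_ ?_ ?_
  · simp only [ne_eq, Fin.mk.injEq]; omega
  · intro x hx
    simp only [ne_eq, Fin.ext_iff] at hx
    simp only [pathPower_adj]; omega
  · intro x hx
    simp only [ne_eq, Fin.ext_iff] at hx
    simp only [pathPower_adj]; omega
  · simp only [ne_eq, Fin.mk.injEq]; omega
  · simp only [ne_eq, Fin.mk.injEq]; omega
  · intro x hxu hxw
    simp only [ne_eq, Fin.ext_iff] at hxu hxw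
    have : ∃ y, y < n ∧ y ≠ k - 1 ∧ y ≠ k ∧ x.val ≠ y ∧ x.val ≤ y + k ∧ y ≤ x.val + k := by
      by_cases h₀ : x.val = 0
      · exact ⟨1, by omega⟩
      · by_cases h₁ : x.val < k
        · exact ⟨x.val - 1, by omega⟩
        · by_cases h₂ : x.val = k + 1
          · exact ⟨1, by omega⟩
          · exact ⟨x.val - 1, by omega⟩
    obtain ⟨y, hy, h₁, h₂, h₃⟩ := this
    exact ⟨⟨y, hy⟩, by simpa [Fin.ext_iff] using h₁, by simpa [Fin.ext_iff] using h₂,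
      pathPower_adj.2 h₃⟩

/-- Differences of two powers of two have unique exponents. -/
theorem two_pow_sub_two_pow_inj {a b c d : ℕ} (hab : b < a) (hcd : d < c)
    (h : 2 ^ a - 2 ^ b = 2 ^ c - 2 ^ d) : a = c ∧ b = d := by
  have not_lt_of_eq : ∀ {a b c d : ℕ}, b < a → d < c → 2 ^ a - 2 ^ b = 2 ^ c - 2 ^ d → ¬ a < c := by
    intro a b c d hab hcd h hac
    have h₁ : 2 ^ a ≤ 2 ^ (c - 1) := Nat.pow_le_pow_right two_pos (by omega)
    have h₂ : 2 ^ d ≤ 2 ^ (c - 1) := Nat.pow_le_pow_right two_pos (by omega)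
    have h₃ : 2 ^ c = 2 * 2 ^ (c - 1) := by
      rw [← pow_succ', Nat.sub_add_cancel (by omega)]
    have h₄ : 0 < 2 ^ b := by positivity
    have h₅ : 2 ^ b < 2 ^ a := Nat.pow_lt_pow_right one_lt_two hab
    omega
  have hac : a = c :=
    le_antisymm (not_lt.1 (not_lt_of_eq hcd hab h.symm)) (not_lt.1 (not_lt_of_eq hab hcd h))
  subst hac
  have h₁ : 2 ^ b < 2 ^ a := Nat.pow_lt_pow_right one_lt_two hab
  have h₂ : 2 ^ d < 2 ^ a := Nat.pow_lt_pow_right one_lt_two hcd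
  exact ⟨rfl, Nat.pow_right_injective le_rfl (by simp only; omega)⟩

/-- The labelling `i ↦ 2 ^ i` is a gap-vertex-labelling of `P_n^k` when `2 * k < n`. -/
theorem gapVertexLabelable_pathPower {n k : ℕ} (hk : 2 ≤ k) (hnk : 2 * k < n) :
    GapVertexLabelable (pathPower n k) := by
  have hcolor : ∀ v : Fin n, ∃ a b : ℕ, b < a ∧
      b = (if v.val = 0 then 1 else v.val - k) ∧
      a = (if v.val = n - 1 then n - 2 else min (v.val + k) (n - 1)) ∧
      gapColor (pathPower n k) (fun i => 2 ^ i.val) v = 2 ^ a - 2 ^ b := by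
    intro v
    have hv := v.isLt
    refine ⟨_, _, ?_, rfl, rfl, ?_⟩
    · split_ifs <;> omega
    · refine gapColor_eq_sub (π := fun i : Fin n => 2 ^ i.val)
        (a := ⟨if v.val = n - 1 then n - 2 else min (v.val + k) (n - 1), by split_ifs <;> omega⟩)
        (b := ⟨if v.val = 0 then 1 else v.val - k, by split_ifs <;> omega⟩) ?_ ?_ ?_ ?_ ?_
      · simp only [ne_eq, Fin.mk.injEq]; split_ifs <;> omega
      · simp only [pathPower_adj]; split_ifs <;> omega
      · simp only [pathPower_adj]; split_ifs <;> omega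
      all_goals
        intro x hx
        have hx' := x.isLt
        rw [pathPower_adj] at hx
        refine Nat.pow_le_pow_right two_pos ?_
        dsimp only
        split_ifs <;> omega
  refine ⟨2 ^ n, Nat.one_le_two_pow, fun i => 2 ^ i.val,
    fun v => ⟨Nat.one_le_two_pow, Nat.pow_le_pow_right two_pos v.isLt.le⟩, ?_⟩
  intro u v huv heq
  obtain ⟨a, b, hab, hb, ha, hu⟩ := hcolor u
  obtain ⟨c, d, hcd, hd, hc, hv⟩ := hcolor v
  rw [hu, hv] at heq
  obtain ⟨rfl, rfl⟩ := two_pow_sub_two_pow_inj hab hcd heq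
  rw [pathPower_adj] at huv
  have hun := u.isLt
  have hvn := v.isLt
  clear heq hu hv hcolor
  split_ifs at ha hb hc hd <;> omega

theorem gapVertexLabelable_pathPower_three_two : GapVertexLabelable (pathPower 3 2) := by
  have h₀ : gapColor (pathPower 3 2) ![2, 1, 4] 0 = 3 :=
    gapColor_eq_sub (a := 2) (b := 1) (by decide) (by simp [pathPower_adj])
      (by simp [pathPower_adj]) (by simp only [pathPower_adj]; decide)
      (by simp only [pathPower_adj]; decide)
  have h₁ : gapColor (pathPower 3 2) ![2, 1, 4] 1 = 2 :=
    gapColor_eq_sub (a := 2) (b := 0) (by decide) (by simp [pathPower_adj])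
      (by simp [pathPower_adj]) (by simp only [pathPower_adj]; decide)
      (by simp only [pathPower_adj]; decide)
  have h₂ : gapColor (pathPower 3 2) ![2, 1, 4] 2 = 1 :=
    gapColor_eq_sub (a := 0) (b := 1) (by decide) (by simp [pathPower_adj])
      (by simp [pathPower_adj]) (by simp only [pathPower_adj]; decide)
      (by simp only [pathPower_adj]; decide)
  refine ⟨4, by norm_num, ![2, 1, 4], by decide, fun u v huv => ?_⟩
  have hne := huv.ne
  fin_cases u <;> fin_cases v <;> simp_all

theorem gapVertexLabelable_pathPower_four_two : GapVertexLabelable (pathPower 4 2) := by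
  have h₀ : gapColor (pathPower 4 2) ![2, 1, 4, 2] 0 = 3 :=
    gapColor_eq_sub (a := 2) (b := 1) (by decide) (by simp [pathPower_adj])
      (by simp [pathPower_adj]) (by simp only [pathPower_adj]; decide)
      (by simp only [pathPower_adj]; decide)
  have h₁ : gapColor (pathPower 4 2) ![2, 1, 4, 2] 1 = 2 :=
    gapColor_eq_sub (a := 2) (b := 0) (by decide) (by simp [pathPower_adj])
      (by simp [pathPower_adj]) (by simp only [pathPower_adj]; decide)
      (by simp only [pathPower_adj]; decide)
  have h₂ : gapColor (pathPower 4 2) ![2, 1, 4, 2] 2 = 1 :=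
    gapColor_eq_sub (a := 0) (b := 1) (by decide) (by simp [pathPower_adj])
      (by simp [pathPower_adj]) (by simp only [pathPower_adj]; decide)
      (by simp only [pathPower_adj]; decide)
  have h₃ : gapColor (pathPower 4 2) ![2, 1, 4, 2] 3 = 3 :=
    gapColor_eq_sub (a := 2) (b := 1) (by decide) (by simp [pathPower_adj])
      (by simp [pathPower_adj]) (by simp only [pathPower_adj]; decide)
      (by simp only [pathPower_adj]; decide)
  refine ⟨4, by norm_num, ![2, 1, 4, 2], by decide, fun u v huv => ?_⟩
  rw [pathPower_adj] at huv
  fin_cases u <;> fin_cases v <;> simp_all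

/-- For `n ≥ 3` and `2 ≤ k < n`, the power of a path `P_n^k` is gap-vertex-labelable iff
`(n = 3 ∧ k = 2)`, `(n = 4 ∧ k = 2)`, or `n ≥ 5` and `2k < n`. -/
theorem pathPower_gapVertexLabelable_iff (n k : ℕ) (hn : 3 ≤ n) (hk : 2 ≤ k) (hkn : k < n) :
    GapVertexLabelable (pathPower n k) ↔
      (n = 3 ∧ k = 2) ∨ (n = 4 ∧ k = 2) ∨ (5 ≤ n ∧ 2 * k < n) := by
  constructor
  · intro h
    by_contra hcon
    exact not_gapVertexLabelable_pathPower (by omega) hkn (by omega) h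
  · rintro (⟨rfl, rfl⟩ | ⟨rfl, rfl⟩ | ⟨-, hnk⟩)
    · exact gapVertexLabelable_pathPower_three_two
    · exact gapVertexLabelable_pathPower_four_two
    · exact gapVertexLabelable_pathPower hk hnk
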